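/- Let 𝒞 be a partition of E^9 into 13 codes, each of minimum Hamming distance at least 4. If 𝒞 contains a code C of size 16 (in particular, the doubly extended Hamming code) and |Aut(𝒞)| ≥ 2, then there is a subgroup H ≤ Aut(𝒞) of prime order which is also a subgroup of Aut(C). -/

import Mathlib

abbrev Word (n : ℕ) := Fin n → ZMod 2

/-- Membership in the group `Gₙ` of operations maintaining equivalence of even binary
codes: permutations of words of the form `x ↦ π·x + c` where `π` permutes the `n`
coordinates and `c` is an even-weight word. -/
def GnSet (n : ℕ) : Set (Equiv.Perm (Word n)) :=
  {g | ∃ (π : Equiv.Perm (Fin n)) (c : Word n), Even (hammingNorm c) ∧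
    ∀ (x : Word n) (i : Fin n), g x i = x (π⁻¹ i) + c i}

/-- `𝒞` is a partition of the set `Eⁿ` of even-weight words of length `n`. -/
def IsPartitionOfEn (n : ℕ) (𝒞 : Finset (Finset (Word n))) : Prop :=
  (∀ C ∈ 𝒞, C.Nonempty) ∧ (𝒞 : Set (Finset (Word n))).PairwiseDisjoint id ∧
    ∀ x : Word n, Even (hammingNorm x) ↔ ∃ C ∈ 𝒞, x ∈ C

/-- The action of `g` on a code. -/
def actCode {n : ℕ} (g : Equiv.Perm (Word n)) (C : Finset (Word n)) : Finset (Word n) :=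
  C.image ⇑g

/-- The action of `g` on a partition. -/
def actPart {n : ℕ} (g : Equiv.Perm (Word n)) (𝒞 : Finset (Finset (Word n))) :
    Finset (Finset (Word n)) :=
  𝒞.image (actCode g)

/-- The automorphism group of a partition, as a subset of the permutations. -/
def autPart (n : ℕ) (𝒞 : Finset (Finset (Word n))) : Set (Equiv.Perm (Word n)) :=
  {g | g ∈ GnSet n ∧ actPart g 𝒞 = 𝒞}

theorem natCast_hammingNorm_eq_sum {n : ℕ} (x : Word n) :
    ((hammingNorm x : ℕ) : ZMod 2) = ∑ i, x i := by
  have h : ∀ a : ZMod 2, (if a ≠ 0 then (1 : ZMod 2) else 0) = a := by decide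
  simp only [hammingNorm, Finset.card_filter, Nat.cast_sum, Nat.cast_ite, Nat.cast_one,
    Nat.cast_zero, h]

theorem even_hammingNorm_iff_sum_eq_zero {n : ℕ} (x : Word n) :
    Even (hammingNorm x) ↔ ∑ i, x i = 0 := by
  rw [← natCast_hammingNorm_eq_sum, ZMod.natCast_eq_zero_iff_even]

theorem even_hammingDist {n : ℕ} {x y : Word n} (hx : Even (hammingNorm x))
    (hy : Even (hammingNorm y)) : Even (hammingDist x y) := by
  rw [even_hammingNorm_iff_sum_eq_zero] at hx hy
  rw [hammingDist_eq_hammingNorm, even_hammingNorm_iff_sum_eq_zero]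
  simp [Finset.sum_add_distrib, hx, hy]

/-- Over a two-letter alphabet, every coordinate distinguishes at most two of the three pairs
formed by three words. -/
theorem hammingDist_add_add_le {n : ℕ} (x y z : Word n) :
    hammingDist x y + hammingDist x z + hammingDist y z ≤ 2 * n := by
  have h : ∀ a b c : ZMod 2, ((if a ≠ b then 1 else 0) + (if a ≠ c then 1 else 0) +
      (if b ≠ c then 1 else 0) : ℕ) ≤ 2 := by decide
  simp only [hammingDist, Finset.card_filter, ← Finset.sum_add_distrib]
  calc _ ≤ ∑ _i : Fin n, 2 := Finset.sum_le_sum fun i _ => h _ _ _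
    _ = 2 * n := by simp [mul_comm]

/-- The nontrivial real character of `ZMod 2`. -/
def binarySign (a : ZMod 2) : ℤ := if a = 0 then 1 else -1

theorem odd_binarySign (a : ZMod 2) : Odd (binarySign a) := by
  revert a; decide

theorem binarySign_mul_self (a : ZMod 2) : binarySign a * binarySign a = 1 := by
  revert a; decide

theorem sum_binarySign_mul {n : ℕ} (x y : Word n) :
    ∑ i, binarySign (x i) * binarySign (y i) = n - 2 * hammingDist x y := by
  have h : ∀ a b : ZMod 2, binarySign a * binarySign b = 1 - 2 * (if a ≠ b then 1 else 0) := by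
    decide
  simp only [hammingDist, Finset.card_filter, h, Finset.sum_sub_distrib, ← Finset.mul_sum]
  simp

theorem one_le_sq_sum_of_odd {ι : Type*} (T : Finset ι) (f : ι → ℤ) (hf : ∀ x, Odd (f x))
    (hT : Odd T.card) : 1 ≤ (∑ x ∈ T, f x) ^ 2 := by
  have h : Odd (∑ x ∈ T, f x) := by
    rw [← ZMod.intCast_eq_one_iff_odd, Int.cast_sum,
      Finset.sum_congr rfl fun x _ => ZMod.intCast_eq_one_iff_odd.2 (hf x)]
    simpa using ZMod.natCast_eq_one_iff_odd.2 hT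
  have h0 : (∑ x ∈ T, f x) ≠ 0 := by
    intro h0
    simp [h0] at h
  have := sq_pos_of_ne_zero h0
  lia

theorem sum_sum_sum_mul_eq_sum_sq {ι κ : Type*} [Fintype κ] (T : Finset ι) (f : κ → ι → ℤ) :
    ∑ x ∈ T, ∑ y ∈ T, ∑ k, f k x * f k y = ∑ k, (∑ x ∈ T, f k x) ^ 2 := by
  simp only [sq, Finset.sum_mul_sum]
  rw [Finset.sum_comm]
  simp only [Finset.sum_comm (t := T) (s := Finset.univ)]
  exact Finset.sum_comm

theorem le_sum_sum_sub_hammingDist {n : ℕ} (T : Finset (Word n)) (hT : Odd T.card) :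
    (n : ℤ) ≤ ∑ x ∈ T, ∑ y ∈ T, ((n : ℤ) - 2 * hammingDist x y) := by
  simp only [← sum_binarySign_mul]
  rw [sum_sum_sum_mul_eq_sum_sq T fun i (x : Word n) => binarySign (x i)]
  calc (n : ℤ) = ∑ _i : Fin n, 1 := by simp
    _ ≤ _ := Finset.sum_le_sum fun i _ =>
      one_le_sq_sum_of_odd T _ (fun x => odd_binarySign (x i)) hT

theorem le_sum_sum_sub_hammingDist_sq {n : ℕ} (T : Finset (Word n)) (hT : Odd T.card) :
    (n : ℤ) * (n - 1) + n * T.card ^ 2 ≤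
      ∑ x ∈ T, ∑ y ∈ T, ((n : ℤ) - 2 * hammingDist x y) ^ 2 := by
  have hsq : ∀ x y : Word n, ((n : ℤ) - 2 * hammingDist x y) ^ 2 =
      ∑ p : Fin n × Fin n, binarySign (x p.1) * binarySign (x p.2) *
        (binarySign (y p.1) * binarySign (y p.2)) := by
    intro x y
    rw [← sum_binarySign_mul, sq, Finset.sum_mul_sum, Fintype.sum_prod_type]
    exact Finset.sum_congr rfl fun i _ => Finset.sum_congr rfl fun j _ => by ring
  simp only [hsq]
  rw [sum_sum_sum_mul_eq_sum_sq T fun (p : Fin n × Fin n) (x : Word n) =>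
    binarySign (x p.1) * binarySign (x p.2)]
  calc (n : ℤ) * (n - 1) + n * T.card ^ 2
      = ∑ p : Fin n × Fin n, (1 + if p.1 = p.2 then (T.card : ℤ) ^ 2 - 1 else 0) := by
        rw [Fintype.sum_prod_type]
        simp [Finset.sum_add_distrib]
        ring
    _ ≤ _ := Finset.sum_le_sum fun p _ => by
        split_ifs with h
        · simp [h, binarySign_mul_self]
        · simpa using one_le_sq_sum_of_odd T _
            (fun x => (odd_binarySign (x p.1)).mul (odd_binarySign (x p.2))) hT

theorem card_ne_twentyOne (T : Finset (Word 9)) (heven : ∀ x ∈ T, Even (hammingNorm x))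
    (hdist : ∀ x ∈ T, ∀ y ∈ T, x ≠ y → 4 ≤ hammingDist x y) : T.card ≠ 21 := by
  intro hT
  have hodd : Odd T.card := by rw [hT]; decide
  have h1 := le_sum_sum_sub_hammingDist T hodd
  have h2 := le_sum_sum_sub_hammingDist_sq T hodd
  have hpair : ∀ x ∈ T, ∀ y ∈ T,
      ((9 : ℕ) - 2 * hammingDist x y : ℤ) ^ 2 + 2 * ((9 : ℕ) - 2 * hammingDist x y : ℤ) =
        3 + (if x = y then 96 else 0) + 32 * (if hammingDist x y = 8 then 1 else 0) := by
    intro x hx y hy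
    by_cases hxy : x = y
    · simp [hxy]
    · have h4 := hdist x hx y hy hxy
      have h9 : hammingDist x y ≤ 9 := by simpa using hammingDist_le_card_fintype (x := x) (y := y)
      have he := even_hammingDist (heven x hx) (heven y hy)
      generalize hammingDist x y = d at *
      interval_cases d <;> simp_all <;> revert he <;> decide
  have hrow : ∀ x ∈ T, ∑ y ∈ T, (((9 : ℕ) - 2 * hammingDist x y : ℤ) ^ 2 +
      2 * ((9 : ℕ) - 2 * hammingDist x y : ℤ)) ≤ 191 := by
    intro x hx
    have h8 : (T.filter fun y => hammingDist x y = 8).card ≤ 1 := by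
      refine Finset.card_le_one.2 fun y hy z hz => ?_
      rw [Finset.mem_filter] at hy hz
      by_contra hyz
      have := hdist y hy.1 z hz.1 hyz
      have := hammingDist_add_add_le x y z
      lia
    rw [Finset.sum_congr rfl (hpair x hx), Finset.sum_add_distrib, Finset.sum_add_distrib,
      ← Finset.mul_sum, ← Finset.sum_filter (p := fun y => hammingDist x y = 8)]
    simp [hT, hx]
    lia
  have htotal := Finset.sum_le_sum hrow
  simp only [Finset.sum_add_distrib, ← Finset.mul_sum, Finset.sum_const, hT] at htotal
  simp only [hT] at h2
  norm_num at h1 h2 htotal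
  linarith

/-- An even-weight code of length nine and minimum distance four has at most twenty words. -/
theorem card_le_twenty (T : Finset (Word 9)) (heven : ∀ x ∈ T, Even (hammingNorm x))
    (hdist : ∀ x ∈ T, ∀ y ∈ T, x ≠ y → 4 ≤ hammingDist x y) : T.card ≤ 20 := by
  by_contra! h
  obtain ⟨S, hST, hS⟩ := Finset.exists_subset_card_eq (show 21 ≤ T.card from h)
  exact card_ne_twentyOne S (fun x hx => heven x (hST hx))
    (fun x hx y hy => hdist x (hST hx) y (hST hy)) hS

theorem card_even_words_nine :
    (Finset.univ.filter fun x : Word 9 => Even (hammingNorm x)).card = 256 := by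
  decide +kernel

theorem IsPartitionOfEn.sum_card {n : ℕ} {𝒞 : Finset (Finset (Word n))}
    (h : IsPartitionOfEn n 𝒞) :
    ∑ C ∈ 𝒞, C.card = (Finset.univ.filter fun x : Word n => Even (hammingNorm x)).card := by
  have hU : 𝒞.biUnion id = Finset.univ.filter fun x : Word n => Even (hammingNorm x) := by
    ext x
    simp [h.2.2 x]
  rw [← hU, Finset.card_biUnion fun C hC D hD => h.2.1 hC hD]
  rfl

theorem eq_of_card_eq_sixteen {𝒞 : Finset (Finset (Word 9))} (hpart : IsPartitionOfEn 9 𝒞)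
    (hcard : 𝒞.card = 13)
    (hdist : ∀ C ∈ 𝒞, ∀ x ∈ C, ∀ y ∈ C, x ≠ y → 4 ≤ hammingDist x y)
    {C D : Finset (Word 9)} (hC : C ∈ 𝒞) (hD : D ∈ 𝒞) (hC16 : C.card = 16)
    (hD16 : D.card = 16) : D = C := by
  by_contra hne
  have hsum := hpart.sum_card
  rw [card_even_words_nine, ← Finset.add_sum_erase _ _ hC,
    ← Finset.add_sum_erase _ _ (Finset.mem_erase.2 ⟨hne, hD⟩)] at hsum
  have hle : ∑ B ∈ (𝒞.erase C).erase D, B.card ≤ ((𝒞.erase C).erase D).card • 20 :=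
    Finset.sum_le_card_nsmul _ _ _ fun B hB => by
      have hB' := Finset.mem_of_mem_erase (Finset.mem_of_mem_erase hB)
      exact card_le_twenty B (fun x hx => (hpart.2.2 x).2 ⟨B, hB', hx⟩) (hdist B hB')
  rw [Finset.card_erase_of_mem (Finset.mem_erase.2 ⟨hne, hD⟩), Finset.card_erase_of_mem hC,
    hcard, smul_eq_mul] at hle
  lia

theorem actCode_one {n : ℕ} (C : Finset (Word n)) : actCode 1 C = C := by
  simp [actCode]

theorem actCode_mul {n : ℕ} (g h : Equiv.Perm (Word n)) (C : Finset (Word n)) :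
    actCode (g * h) C = actCode g (actCode h C) := by
  simp [actCode, Finset.image_image]

theorem actPart_mul {n : ℕ} (g h : Equiv.Perm (Word n)) (𝒞 : Finset (Finset (Word n))) :
    actPart (g * h) 𝒞 = actPart g (actPart h 𝒞) := by
  simp only [actPart, Finset.image_image]
  exact Finset.image_congr fun C _ => actCode_mul g h C

theorem one_mem_GnSet (n : ℕ) : (1 : Equiv.Perm (Word n)) ∈ GnSet n :=
  ⟨1, 0, by simp, by simp⟩

theorem mul_mem_GnSet {n : ℕ} {g h : Equiv.Perm (Word n)} (hg : g ∈ GnSet n)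
    (hh : h ∈ GnSet n) : g * h ∈ GnSet n := by
  obtain ⟨π, c, hc, hg⟩ := hg
  obtain ⟨ρ, d, hd, hh⟩ := hh
  refine ⟨π * ρ, fun i => d (π⁻¹ i) + c i, ?_, fun x i => ?_⟩
  · rw [even_hammingNorm_iff_sum_eq_zero] at hc hd ⊢
    rw [Finset.sum_add_distrib, Equiv.sum_comp π⁻¹ d, hc, hd, add_zero]
  · simp [hg, hh, mul_inv_rev, add_assoc]

/-- The automorphisms of a partition, as a submonoid of the permutations. -/
def autPartSubmonoid (n : ℕ) (𝒞 : Finset (Finset (Word n))) :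
    Submonoid (Equiv.Perm (Word n)) where
  carrier := autPart n 𝒞
  one_mem' := ⟨one_mem_GnSet n, by simp [actPart, funext actCode_one]⟩
  mul_mem' hg hh := ⟨mul_mem_GnSet hg.1 hh.1, by rw [actPart_mul, hh.2, hg.2]⟩

/-- A nontrivial submonoid of a finite group contains a subgroup of prime order. -/
theorem exists_subgroup_prime_card_of_submonoid {G : Type*} [Group G] [Finite G]
    (M : Submonoid G) {g : G} (hg : g ∈ M) (hg1 : g ≠ 1) :
    ∃ H : Subgroup G, (H : Set G) ⊆ M ∧ (Nat.card H).Prime := by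
  obtain ⟨p, hp, hpg⟩ := Nat.exists_prime_and_dvd (mt orderOf_eq_one_iff.1 hg1)
  refine ⟨Subgroup.zpowers (g ^ (orderOf g / p)), fun x hx => ?_, ?_⟩
  · obtain ⟨k, rfl⟩ := mem_powers_iff_mem_zpowers.2 hx
    exact pow_mem (pow_mem hg _) _
  · rwa [Nat.card_zpowers, orderOf_pow_orderOf_div (orderOf_pos g).ne' hpg]

/-- If a partition `𝒞` of `E⁹` into 13 codes of minimum distance at least 4 contains a
code `C` of size 16 and `|Aut 𝒞| ≥ 2`, then some subgroup `H ≤ Aut 𝒞` of prime order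
satisfies `H ≤ Aut C`. -/
theorem exists_prime_order_subgroup_fixing_hamming
    (𝒞 : Finset (Finset (Word 9))) (hpart : IsPartitionOfEn 9 𝒞)
    (hcard : 𝒞.card = 13)
    (hdist : ∀ C ∈ 𝒞, ∀ x ∈ C, ∀ y ∈ C, x ≠ y → 4 ≤ hammingDist x y)
    (C : Finset (Word 9)) (hC : C ∈ 𝒞) (hC16 : C.card = 16)
    (haut : 2 ≤ (autPart 9 𝒞).ncard) :
    ∃ H : Subgroup (Equiv.Perm (Word 9)),
      (H : Set (Equiv.Perm (Word 9))) ⊆ autPart 9 𝒞 ∧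
      (Nat.card H).Prime ∧
      ∀ h ∈ H, actCode h C = C := by
  obtain ⟨g, hg, hg1⟩ := Set.exists_ne_of_one_lt_ncard haut 1
  obtain ⟨H, hH, hprime⟩ := exists_subgroup_prime_card_of_submonoid (autPartSubmonoid 9 𝒞) hg hg1
  refine ⟨H, hH, hprime, fun h hh => ?_⟩
  have hmem : actCode h C ∈ 𝒞 := by
    have := Finset.mem_image_of_mem (actCode h) hC
    rwa [show 𝒞.image (actCode h) = 𝒞 from (hH hh).2] at this
  exact eq_of_card_eq_sixteen hpart hcard hdist hC hmem hC16
    ((Finset.card_image_of_injective C h.injective).trans hC16)
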